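/- arXiv:1511.03938 — 2 statements merged into one kernel-verified Lean document; each statement's English description precedes it below -/
import Mathlib

section
/- The pair (u, p) with u(r,θ) = (1/(2√r))·(-2φ'(θ) e_r + φ(θ) e_θ) and p(r,θ) = -A²/(4r), where φ(θ) = A√(1 - λ cos(θ - θ₀)) with |λ| < 1, is an exact solution of the stationary incompressible Euler equations u·∇u + ∇p = 0, ∇·u = 0 in ℝ² \ {0}. -/
/-- φ(θ) = A √(1 - λ cos(θ - θ₀)). -/
noncomputable def eulerProfile (A lam θ₀ : ℝ) : ℝ → ℝ :=
  fun θ => A * Real.sqrt (1 - lam * Real.cos (θ - θ₀))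

/-- The velocity field u(r,θ) = (1/(2√r)) (-2φ'(θ) e_r + φ(θ) e_θ),
written on ℂ \ {0}, with e_r = x/|x| and e_θ = i x/|x|. -/
noncomputable def eulerVelocity (A lam θ₀ : ℝ) : ℂ → ℂ := fun x =>
  (1 / (2 * Real.sqrt ‖x‖)) •
    ((-2 * deriv (eulerProfile A lam θ₀) x.arg) • (x / (‖x‖ : ℂ)) +
      (eulerProfile A lam θ₀ x.arg) • (Complex.I * x / (‖x‖ : ℂ)))

/-- The pressure p = -A²/(4r). -/
noncomputable def eulerPressure (A : ℝ) : ℂ → ℝ := fun x => -A ^ 2 / (4 * ‖x‖)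

/-- The gradient of a scalar field on ℝ² ≅ ℂ, as a complex number. -/
noncomputable def grad2 (p : ℂ → ℝ) (x : ℂ) : ℂ :=
  (fderiv ℝ p x 1 : ℝ) + (fderiv ℝ p x Complex.I : ℝ) * Complex.I

/-- The divergence of a vector field on ℝ² ≅ ℂ. -/
noncomputable def div2 (u : ℂ → ℂ) (x : ℂ) : ℝ :=
  (fderiv ℝ u x 1).re + (fderiv ℝ u x Complex.I).im

/-- The function `g(x) = r (1 - λ cos (θ - θ₀))` in Cartesian coordinates; the stream function of
the flow is a multiple of its square root. -/
noncomputable def streamSq (lam θ₀ : ℝ) : ℂ → ℝ := fun x =>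
  ‖x‖ - lam * (Real.cos θ₀ * x.re + Real.sin θ₀ * x.im)

/-- The velocity field in Cartesian coordinates, as the rotated gradient of `A √g`. -/
noncomputable def cartesianVelocity (A lam θ₀ : ℝ) : ℂ → ℂ := fun x =>
  (A / 2 * (Real.sqrt (streamSq lam θ₀ x))⁻¹) •
    (Complex.I * (‖x‖⁻¹ • x - (⟨lam * Real.cos θ₀, lam * Real.sin θ₀⟩ : ℂ)))

theorem one_sub_mul_cos_pos {lam : ℝ} (hlam : |lam| < 1) (t : ℝ) :
    0 < 1 - lam * Real.cos t := by
  have h : |lam * Real.cos t| < 1 := by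
    rw [abs_mul]
    exact (mul_le_of_le_one_right (abs_nonneg _) (Real.abs_cos_le_one t)).trans_lt hlam
  linarith [(abs_lt.1 h).2]

theorem streamSq_eq (lam θ₀ : ℝ) (x : ℂ) :
    streamSq lam θ₀ x = ‖x‖ * (1 - lam * Real.cos (x.arg - θ₀)) := by
  rw [streamSq, Real.cos_sub]
  linear_combination lam * Real.cos θ₀ * Complex.norm_mul_cos_arg x +
    lam * Real.sin θ₀ * Complex.norm_mul_sin_arg x

theorem streamSq_pos {lam : ℝ} (hlam : |lam| < 1) (θ₀ : ℝ) {x : ℂ} (hx : x ≠ 0) :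
    0 < streamSq lam θ₀ x := by
  rw [streamSq_eq]
  exact mul_pos (norm_pos_iff.2 hx) (one_sub_mul_cos_pos hlam _)

theorem hasDerivAt_eulerProfile (A : ℝ) {lam : ℝ} (hlam : |lam| < 1) (θ₀ t : ℝ) :
    HasDerivAt (eulerProfile A lam θ₀)
      (A * (lam * Real.sin (t - θ₀) / (2 * Real.sqrt (1 - lam * Real.cos (t - θ₀))))) t := by
  have h := (((((hasDerivAt_id t).sub_const θ₀).cos).const_mul lam).const_sub 1).sqrt
    (one_sub_mul_cos_pos hlam (t - θ₀)).ne'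
  refine (h.const_mul A).congr_deriv ?_
  simp

theorem eulerVelocity_eq_cartesianVelocity (A : ℝ) {lam : ℝ} (hlam : |lam| < 1) (θ₀ : ℝ) {x : ℂ}
    (hx : x ≠ 0) : eulerVelocity A lam θ₀ x = cartesianVelocity A lam θ₀ x := by
  have hr : 0 < ‖x‖ := norm_pos_iff.2 hx
  have hS := one_sub_mul_cos_pos hlam (x.arg - θ₀)
  have hSq := Real.sq_sqrt hS.le
  have hS' := Real.sqrt_pos.2 hS
  have hr' := Real.sqrt_pos.2 hr
  have hre := Complex.norm_mul_cos_arg x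
  have him := Complex.norm_mul_sin_arg x
  have hre' : x.re / ‖x‖ = Real.cos x.arg := by rw [← hre]; field_simp
  have him' : x.im / ‖x‖ = Real.sin x.arg := by rw [← him]; field_simp
  have hcs := Real.sin_sq_add_cos_sq x.arg
  rw [eulerVelocity, cartesianVelocity, (hasDerivAt_eulerProfile A hlam θ₀ x.arg).deriv,
    streamSq_eq, Real.sqrt_mul hr.le, eulerProfile]
  have hdiv : x / (‖x‖ : ℂ) = ⟨Real.cos x.arg, Real.sin x.arg⟩ := by
    apply Complex.ext
    · rw [Complex.div_ofReal_re, hre']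
    · rw [Complex.div_ofReal_im, him']
  have hsmul : ‖x‖⁻¹ • x = ⟨Real.cos x.arg, Real.sin x.arg⟩ := by
    rw [← hdiv, Complex.real_smul, Complex.ofReal_inv, div_eq_inv_mul]
  rw [mul_div_assoc Complex.I, hdiv, hsmul]
  rw [Real.cos_sub] at hSq hS' ⊢
  rw [Real.sin_sub]
  generalize Real.sqrt (1 - lam * _) = S at *
  generalize Real.sqrt ‖x‖ = R at *
  generalize Real.cos x.arg = c at *
  generalize Real.sin x.arg = s at *
  apply Complex.ext <;> simp only [Complex.add_re, Complex.add_im, Complex.sub_re, Complex.sub_im,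
    Complex.mul_re, Complex.mul_im, Complex.smul_re, Complex.smul_im, Complex.I_re,
    Complex.I_im, smul_eq_mul] <;> field_simp
  · linear_combination -A * s * hSq + A * lam * Real.sin θ₀ * hcs
  · linear_combination A * c * hSq - A * lam * Real.cos θ₀ * hcs

theorem hasFDerivAt_norm_complex {x : ℂ} (hx : x ≠ 0) :
    HasFDerivAt (fun z : ℂ => ‖z‖)
      (‖x‖⁻¹ • (x.re • Complex.reCLM + x.im • Complex.imCLM)) x := by
  have hn : (fun z : ℂ => ‖z‖) = fun z => Real.sqrt (z.re * z.re + z.im * z.im) := by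
    funext z
    rw [Complex.norm_def, Complex.normSq_apply]
  have hx' : x.re * x.re + x.im * x.im ≠ 0 := by
    rw [← Complex.normSq_apply]; exact Complex.normSq_eq_zero.not.2 hx
  have hre : HasFDerivAt (fun z : ℂ => z.re) Complex.reCLM x := Complex.reCLM.hasFDerivAt
  have him : HasFDerivAt (fun z : ℂ => z.im) Complex.imCLM x := Complex.imCLM.hasFDerivAt
  have h := ((hre.mul hre).add (him.mul him)).sqrt hx'
  rw [hn]
  refine h.congr_fderiv ?_
  rw [congrFun hn x]
  ext v
  simp
  ring

theorem fderiv_cartesianVelocity (A : ℝ) {lam : ℝ} (hlam : |lam| < 1) (θ₀ : ℝ) {x : ℂ}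
    (hx : x ≠ 0) (v : ℂ) :
    fderiv ℝ (cartesianVelocity A lam θ₀) x v =
      (-(A / 4) * (‖x‖⁻¹ * (x.re * v.re + x.im * v.im) -
          lam * (Real.cos θ₀ * v.re + Real.sin θ₀ * v.im)) /
        Real.sqrt (streamSq lam θ₀ x) ^ 3) •
          (Complex.I * (‖x‖⁻¹ • x - (⟨lam * Real.cos θ₀, lam * Real.sin θ₀⟩ : ℂ))) +
      (A / 2 * (Real.sqrt (streamSq lam θ₀ x))⁻¹) •
        (Complex.I * (‖x‖⁻¹ • v - ((x.re * v.re + x.im * v.im) / ‖x‖ ^ 3) • x)) := by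
  have hr : 0 < ‖x‖ := norm_pos_iff.2 hx
  have hg := streamSq_pos hlam θ₀ hx
  have hq := Real.sqrt_pos.2 hg
  have hn := hasFDerivAt_norm_complex hx
  have hre : HasFDerivAt (fun z : ℂ => z.re) Complex.reCLM x := Complex.reCLM.hasFDerivAt
  have him : HasFDerivAt (fun z : ℂ => z.im) Complex.imCLM x := Complex.imCLM.hasFDerivAt
  have hG : HasFDerivAt (streamSq lam θ₀) _ x :=
    hn.sub (((hre.const_mul (Real.cos θ₀)).add (him.const_mul (Real.sin θ₀))).const_mul lam)
  have hQ := (((hasDerivAt_inv hq.ne').comp_hasFDerivAt x (hG.sqrt hg.ne')).const_mul (A / 2))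
  have hR := ((hasDerivAt_inv hr.ne').comp_hasFDerivAt x hn)
  have hV := hQ.smul (((hR.smul (hasFDerivAt_id x)).sub_const
    (⟨lam * Real.cos θ₀, lam * Real.sin θ₀⟩ : ℂ)).const_mul Complex.I)
  have hV' : HasFDerivAt (cartesianVelocity A lam θ₀) _ x := hV
  rw [hV'.fderiv]
  clear hV hV' hQ hR hG hn hre him
  simp only [add_apply, sub_apply,
    smul_apply, ContinuousLinearMap.smulRight_apply,
    ContinuousLinearMap.id_apply, Complex.reCLM_apply, Complex.imCLM_apply, Function.comp_apply,
    Pi.smul_apply', id_eq]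
  generalize Real.sqrt (streamSq lam θ₀ x) = q at *
  apply Complex.ext <;> simp only [Complex.add_re, Complex.add_im, Complex.sub_re, Complex.sub_im,
    Complex.mul_re, Complex.mul_im, Complex.smul_re, Complex.smul_im, Complex.I_re,
    Complex.I_im, smul_eq_mul] <;> field_simp <;> ring

theorem grad2_eulerPressure (A : ℝ) {x : ℂ} (hx : x ≠ 0) :
    grad2 (eulerPressure A) x = (A ^ 2 / (4 * ‖x‖ ^ 3)) • x := by
  have hr : 0 < ‖x‖ := norm_pos_iff.2 hx
  have h := ((hasDerivAt_inv hr.ne').comp_hasFDerivAt x (hasFDerivAt_norm_complex hx)).const_mul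
    (-A ^ 2 / 4)
  have hp : eulerPressure A = fun z => -A ^ 2 / 4 * (Inv.inv ∘ fun z : ℂ => ‖z‖) z := by
    funext z
    simp only [eulerPressure, Function.comp_apply]
    rw [← div_div, div_eq_mul_inv _ ‖z‖]
  rw [grad2, hp, h.fderiv]
  simp only [smul_apply, add_apply, Complex.reCLM_apply, Complex.imCLM_apply, smul_eq_mul]
  apply Complex.ext <;> simp only [Complex.add_re, Complex.add_im, Complex.mul_re, Complex.mul_im,
    Complex.smul_re, Complex.smul_im, Complex.I_re, Complex.I_im, Complex.ofReal_re,
    Complex.ofReal_im, Complex.one_re, Complex.one_im, smul_eq_mul] <;> field_simp <;> ring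

/-- The pair (u, p) above is an exact solution of the stationary Euler
equations u·∇u + ∇p = 0, ∇·u = 0 in ℝ² \ {0}. -/
theorem euler_exact_solution (A lam θ₀ : ℝ) (hlam : |lam| < 1) :
    ∀ x : ℂ, x ≠ 0 →
      fderiv ℝ (eulerVelocity A lam θ₀) x (eulerVelocity A lam θ₀ x)
          + grad2 (eulerPressure A) x = 0 ∧
        div2 (eulerVelocity A lam θ₀) x = 0 := by
  intro x hx
  have hev : eulerVelocity A lam θ₀ =ᶠ[nhds x] cartesianVelocity A lam θ₀ := by
    filter_upwards [isOpen_ne.mem_nhds hx] with z hz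
    exact eulerVelocity_eq_cartesianVelocity A hlam θ₀ hz
  have hr : 0 < ‖x‖ := norm_pos_iff.2 hx
  have hg := streamSq_pos hlam θ₀ hx
  have hq := Real.sqrt_pos.2 hg
  have hq2 := Real.sq_sqrt hg.le
  have hr2 : ‖x‖ ^ 2 = x.re ^ 2 + x.im ^ 2 := by
    rw [Complex.sq_norm, Complex.normSq_apply]; ring
  rw [div2, hev.fderiv_eq, hev.eq_of_nhds, grad2_eulerPressure A hx]
  simp only [fderiv_cartesianVelocity A hlam θ₀ hx]
  rw [cartesianVelocity]
  generalize Real.sqrt (streamSq lam θ₀ x) = q at *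
  rw [streamSq] at hq2
  generalize ‖x‖ = r at *
  generalize Real.cos θ₀ = c at *
  generalize Real.sin θ₀ = s at *
  constructor
  · apply Complex.ext <;> simp only [Complex.add_re, Complex.add_im, Complex.sub_re, Complex.sub_im,
    Complex.mul_re, Complex.mul_im, Complex.smul_re, Complex.smul_im, Complex.I_re,
    Complex.I_im, Complex.zero_re, Complex.zero_im, smul_eq_mul] <;> field_simp
    · linear_combination 4 * q ^ 2 * A ^ 2 *
        (r * lam * c * hr2 + r * x.re * hq2)
    · linear_combination 4 * q ^ 2 * A ^ 2 *
        (r * lam * s * hr2 + r * x.im * hq2)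
  · simp only [Complex.add_re, Complex.add_im, Complex.sub_re, Complex.sub_im,
    Complex.mul_re, Complex.mul_im, Complex.smul_re, Complex.smul_im, Complex.I_re,
    Complex.I_im, smul_eq_mul, Complex.one_re, Complex.one_im]
    field_simp
    ring
end

section
/- In polar coordinates on ℝ² \ {0}, the velocity field u = -(3/(2r)) e_r + (A/(2√r) + μ/r) e_θ together with a suitable pressure p is an exact solution of the stationary Navier-Stokes equations Δu - ∇p = u·∇u, ∇·u = 0, with flux ∫_{S¹} u·n = -3π. -/
/-- The (componentwise) Laplacian of a vector field on ℝ² ≅ ℂ. -/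
noncomputable def lap2 (u : ℂ → ℂ) (x : ℂ) : ℂ :=
  fderiv ℝ (fun y => fderiv ℝ u y 1) x 1
    + fderiv ℝ (fun y => fderiv ℝ u y Complex.I) x Complex.I

/-- The Hamel velocity field u = -(3/(2r)) e_r + (A/(2√r) + μ/r) e_θ on ℂ \ {0}. -/
noncomputable def hamelVelocity (A μ : ℝ) : ℂ → ℂ := fun x =>
  (-(3 / (2 * ‖x‖)) : ℝ) • (x / (‖x‖ : ℂ))
    + ((A / (2 * Real.sqrt ‖x‖) + μ / ‖x‖) : ℝ) • (Complex.I * x / (‖x‖ : ℂ))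

/-- Derivative of the field `x ↦ G (‖x‖²) x`. -/
theorem hasFDerivAt_radial_mul {G : ℝ → ℂ} {G' x : ℂ} (hG : HasDerivAt G G' (‖x‖ ^ 2)) :
    HasFDerivAt (fun y : ℂ => G (‖y‖ ^ 2) * y)
      (G (‖x‖ ^ 2) • ContinuousLinearMap.id ℝ ℂ +
        ((ContinuousLinearMap.toSpanSingleton ℝ G').comp (2 • innerSL ℝ x)).smulRight x) x :=
  (hG.hasFDerivAt.comp x (hasStrictFDerivAt_norm_sq x).hasFDerivAt).mul' (hasFDerivAt_id x)

theorem fderiv_radial_mul_apply {G : ℝ → ℂ} {G' x : ℂ} (hG : HasDerivAt G G' (‖x‖ ^ 2)) (v : ℂ) :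
    fderiv ℝ (fun y : ℂ => G (‖y‖ ^ 2) * y) x v =
      G (‖x‖ ^ 2) * v + G' * ((2 * inner ℝ x v : ℝ) : ℂ) * x := by
  rw [(hasFDerivAt_radial_mul hG).fderiv]
  simp [mul_comm]
  left
  ring

theorem fderiv_fderiv_radial_mul_apply {G G₁ : ℝ → ℂ} {G₂ x : ℂ} (hx : x ≠ 0)
    (hG : ∀ s, 0 < s → HasDerivAt G (G₁ s) s) (hG₁ : HasDerivAt G₁ G₂ (‖x‖ ^ 2)) (v : ℂ) :
    fderiv ℝ (fun y => fderiv ℝ (fun z : ℂ => G (‖z‖ ^ 2) * z) y v) x v =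
      4 * G₁ (‖x‖ ^ 2) * ((inner ℝ x v : ℝ) : ℂ) * v +
        4 * G₂ * ((inner ℝ x v : ℝ) : ℂ) ^ 2 * x +
        2 * G₁ (‖x‖ ^ 2) * ((inner ℝ v v : ℝ) : ℂ) * x := by
  have hev : (fun y => fderiv ℝ (fun z : ℂ => G (‖z‖ ^ 2) * z) y v) =ᶠ[nhds x]
      fun y => G (‖y‖ ^ 2) * v + ((2 * inner ℝ v y : ℝ) : ℂ) * (G₁ (‖y‖ ^ 2) * y) := by
    filter_upwards [isOpen_ne.mem_nhds hx] with y hy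
    have hy' : 0 < ‖y‖ ^ 2 := by have := norm_pos_iff.2 hy; positivity
    rw [fderiv_radial_mul_apply (hG _ hy'), real_inner_comm]
    ring
  have hx' : 0 < ‖x‖ ^ 2 := by have := norm_pos_iff.2 hx; positivity
  have h1 := ((hG _ hx').hasFDerivAt.comp x
    (hasStrictFDerivAt_norm_sq x).hasFDerivAt).mul_const' v
  have h2 : HasFDerivAt (fun y : ℂ => ((2 * inner ℝ v y : ℝ) : ℂ))
      (Complex.ofRealCLM.comp ((2 : ℝ) • innerSL ℝ v)) x :=
    (Complex.ofRealCLM.comp ((2 : ℝ) • innerSL ℝ v)).hasFDerivAt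
  have h3 := h1.add (h2.mul' (hasFDerivAt_radial_mul hG₁))
  rw [hev.fderiv_eq]
  refine (congrArg (fun L : ℂ →L[ℝ] ℂ => L v) h3.fderiv).trans ?_
  simp [real_inner_comm v x]
  ring

theorem lap2_radial_mul {G G₁ : ℝ → ℂ} {G₂ x : ℂ} (hx : x ≠ 0)
    (hG : ∀ s, 0 < s → HasDerivAt G (G₁ s) s) (hG₁ : HasDerivAt G₁ G₂ (‖x‖ ^ 2)) :
    lap2 (fun z : ℂ => G (‖z‖ ^ 2) * z) x =
      (4 * ((‖x‖ ^ 2 : ℝ) : ℂ) * G₂ + 8 * G₁ (‖x‖ ^ 2)) * x := by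
  have hN : ((‖x‖ ^ 2 : ℝ) : ℂ) = (x.re : ℂ) ^ 2 + (x.im : ℂ) ^ 2 := by
    rw [← Complex.normSq_eq_norm_sq, Complex.normSq_apply]; push_cast; ring
  rw [lap2, fderiv_fderiv_radial_mul_apply hx hG hG₁, fderiv_fderiv_radial_mul_apply hx hG hG₁, hN]
  simp only [Complex.inner, map_one, Complex.conj_I, Complex.mul_re, Complex.conj_re,
    Complex.conj_im, Complex.one_re, Complex.one_im, Complex.I_re, Complex.I_im, Complex.neg_re,
    Complex.neg_im]
  push_cast
  linear_combination (4 * G₁ (‖x‖ ^ 2)) * Complex.re_add_im x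

theorem div2_radial_mul {G : ℝ → ℂ} {G' x : ℂ} (hG : HasDerivAt G G' (‖x‖ ^ 2)) :
    div2 (fun z : ℂ => G (‖z‖ ^ 2) * z) x =
      2 * (G (‖x‖ ^ 2)).re + 2 * G'.re * ‖x‖ ^ 2 := by
  have hN : ‖x‖ ^ 2 = x.re ^ 2 + x.im ^ 2 := by
    rw [← Complex.normSq_eq_norm_sq, Complex.normSq_apply]; ring
  rw [div2, fderiv_radial_mul_apply hG, fderiv_radial_mul_apply hG]
  simp [Complex.inner]
  rw [hN]
  ring

theorem grad2_radial {P : ℝ → ℝ} {P' : ℝ} {x : ℂ} (hP : HasDerivAt P P' (‖x‖ ^ 2)) :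
    grad2 (fun z : ℂ => P (‖z‖ ^ 2)) x = 2 * (P' : ℂ) * x := by
  have h := hP.hasFDerivAt.comp x (hasStrictFDerivAt_norm_sq x).hasFDerivAt
  have h' : fderiv ℝ (fun z : ℂ => P (‖z‖ ^ 2)) x = _ := h.fderiv
  rw [grad2, h']
  apply Complex.ext <;> simp [Complex.inner] <;> ring

/-- The profile of the Hamel field: `u x = hamelProfile A μ (‖x‖²) * x`. -/
noncomputable def hamelProfile (A μ s : ℝ) : ℂ :=
  (-(3 / 2) + μ * Complex.I) * ((s ^ (-1 : ℝ) : ℝ) : ℂ) +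
    A / 2 * Complex.I * ((s ^ (-3 / 4 : ℝ) : ℝ) : ℂ)

theorem hamelVelocity_eq (A μ : ℝ) :
    hamelVelocity A μ = fun x => hamelProfile A μ (‖x‖ ^ 2) * x := by
  funext x
  rcases eq_or_ne x 0 with rfl | hx
  · simp [hamelVelocity]
  have hr : 0 < ‖x‖ := norm_pos_iff.2 hx
  have h1 : (‖x‖ ^ 2) ^ (-1 : ℝ) = (‖x‖ ^ 2)⁻¹ := Real.rpow_neg_one _
  have h2 : (‖x‖ ^ 2) ^ (-3 / 4 : ℝ) = (‖x‖ * √‖x‖)⁻¹ := by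
    rw [← Real.rpow_natCast, ← Real.rpow_mul hr.le, Real.sqrt_eq_rpow, ← Real.rpow_one_add' hr.le,
      ← Real.rpow_neg hr.le] <;> norm_num
  have hs : (√‖x‖ : ℂ) ≠ 0 := by exact_mod_cast (Real.sqrt_pos.2 hr).ne'
  have hr' : (‖x‖ : ℂ) ≠ 0 := by exact_mod_cast hr.ne'
  simp only [hamelVelocity, hamelProfile, h1, h2, Complex.real_smul]
  push_cast
  field_simp
  ring

theorem hasDerivAt_ofReal_rpow (a : ℝ) {s : ℝ} (hs : 0 < s) :
    HasDerivAt (fun t : ℝ => ((t ^ a : ℝ) : ℂ)) (a * ((s ^ (a - 1) : ℝ) : ℂ)) s := by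
  simpa using (Real.hasDerivAt_rpow_const (p := a) (Or.inl hs.ne')).ofReal_comp

/-- First derivative of `hamelProfile`. -/
noncomputable def hamelProfileDeriv (A μ s : ℝ) : ℂ :=
  (-(3 / 2) + μ * Complex.I) * (((-1 : ℝ) : ℂ) * ((s ^ (-1 - 1 : ℝ) : ℝ) : ℂ)) +
    A / 2 * Complex.I * (((-3 / 4 : ℝ) : ℂ) * ((s ^ (-3 / 4 - 1 : ℝ) : ℝ) : ℂ))

theorem hasDerivAt_hamelProfile (A μ : ℝ) {s : ℝ} (hs : 0 < s) :
    HasDerivAt (hamelProfile A μ) (hamelProfileDeriv A μ s) s :=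
  ((hasDerivAt_ofReal_rpow _ hs).const_mul _).add ((hasDerivAt_ofReal_rpow _ hs).const_mul _)

/-- Second derivative of `hamelProfile`. -/
noncomputable def hamelProfileDeriv₂ (A μ s : ℝ) : ℂ :=
  (-(3 / 2) + μ * Complex.I) *
      (((-1 : ℝ) : ℂ) * (((-1 - 1 : ℝ) : ℂ) * ((s ^ (-1 - 1 - 1 : ℝ) : ℝ) : ℂ))) +
    A / 2 * Complex.I *
      (((-3 / 4 : ℝ) : ℂ) * (((-3 / 4 - 1 : ℝ) : ℂ) * ((s ^ (-3 / 4 - 1 - 1 : ℝ) : ℝ) : ℂ)))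

theorem hasDerivAt_hamelProfileDeriv (A μ : ℝ) {s : ℝ} (hs : 0 < s) :
    HasDerivAt (hamelProfileDeriv A μ) (hamelProfileDeriv₂ A μ s) s :=
  (((hasDerivAt_ofReal_rpow _ hs).const_mul _).const_mul _).add
    (((hasDerivAt_ofReal_rpow _ hs).const_mul _).const_mul _)

/-- The pressure of the Hamel field as a function of `s = ‖x‖²`. -/
noncomputable def hamelPressure (A μ s : ℝ) : ℝ :=
  -(9 / 8 + μ ^ 2 / 2) * s ^ (-1 : ℝ) + -(A ^ 2 / 4) * s ^ (-1 / 2 : ℝ) +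
    -(2 / 3 * A * μ) * s ^ (-3 / 4 : ℝ)

theorem hasDerivAt_hamelPressure (A μ : ℝ) {s : ℝ} (hs : 0 < s) :
    HasDerivAt (hamelPressure A μ)
      (-(9 / 8 + μ ^ 2 / 2) * (-1 * s ^ (-1 - 1 : ℝ)) +
        -(A ^ 2 / 4) * (-1 / 2 * s ^ (-1 / 2 - 1 : ℝ)) +
        -(2 / 3 * A * μ) * (-3 / 4 * s ^ (-3 / 4 - 1 : ℝ))) s :=
  (((Real.hasDerivAt_rpow_const (Or.inl hs.ne')).const_mul _).add
    ((Real.hasDerivAt_rpow_const (Or.inl hs.ne')).const_mul _)).add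
    ((Real.hasDerivAt_rpow_const (Or.inl hs.ne')).const_mul _)

theorem pow_four_rpow {t : ℝ} (ht : 0 < t) (a : ℝ) (n : ℕ) (h : 4 * a = -n) :
    (t ^ 4) ^ a = (t ^ n)⁻¹ := by
  rw [← Real.rpow_natCast t 4, ← Real.rpow_mul ht.le, ← Real.rpow_natCast t n,
    ← Real.rpow_neg ht.le]
  congr 1

theorem inner_self_mul (g x : ℂ) : inner ℝ x (g * x) = g.re * ‖x‖ ^ 2 := by
  rw [← Complex.normSq_eq_norm_sq, Complex.normSq_apply, Complex.inner]
  simp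
  ring

theorem re_hamelProfile (A μ s : ℝ) : (hamelProfile A μ s).re = -(3 / 2) * s ^ (-1 : ℝ) := by
  simp [hamelProfile]

theorem re_hamelProfileDeriv (A μ s : ℝ) :
    (hamelProfileDeriv A μ s).re = 3 / 2 * s ^ (-1 - 1 : ℝ) := by
  simp [hamelProfileDeriv]

/-- The field u = -(3/(2r)) e_r + (A/(2√r) + μ/r) e_θ, with a suitable
pressure, solves the stationary Navier-Stokes equations Δu - ∇p = u·∇u,
∇·u = 0 on ℝ² \ {0}, and has flux -3π through the unit circle. -/
theorem hamel_exact_solution (A μ : ℝ) :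
    ∃ p : ℂ → ℝ,
      (∀ x : ℂ, x ≠ 0 →
        lap2 (hamelVelocity A μ) x
            = grad2 p x +
              fderiv ℝ (hamelVelocity A μ) x (hamelVelocity A μ x) ∧
          div2 (hamelVelocity A μ) x = 0) ∧
      (∫ θ in (0 : ℝ)..(2 * Real.pi),
          (hamelVelocity A μ (Complex.exp (θ * Complex.I)) *
            (starRingEnd ℂ) (Complex.exp (θ * Complex.I))).re)
        = -3 * Real.pi := by
  refine ⟨fun z => hamelPressure A μ (‖z‖ ^ 2), fun x hx => ?_, ?_⟩
  · rw [hamelVelocity_eq]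
    have hs : 0 < ‖x‖ ^ 2 := by have := norm_pos_iff.2 hx; positivity
    have hG := hasDerivAt_hamelProfile A μ hs
    obtain ⟨t, ht, hts⟩ : ∃ t : ℝ, 0 < t ∧ ‖x‖ ^ 2 = t ^ 4 :=
      ⟨√‖x‖, Real.sqrt_pos.2 (norm_pos_iff.2 hx), by
        rw [show (4 : ℕ) = 2 * 2 from rfl, pow_mul, Real.sq_sqrt (norm_nonneg x)]⟩
    have e1 : (t ^ 4) ^ (-1 : ℝ) = (t ^ 4)⁻¹ := pow_four_rpow ht _ 4 (by norm_num)
    have e2 : (t ^ 4) ^ (-1 - 1 : ℝ) = (t ^ 8)⁻¹ := pow_four_rpow ht _ 8 (by norm_num)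
    have e3 : (t ^ 4) ^ (-1 - 1 - 1 : ℝ) = (t ^ 12)⁻¹ := pow_four_rpow ht _ 12 (by norm_num)
    have e4 : (t ^ 4) ^ (-3 / 4 : ℝ) = (t ^ 3)⁻¹ := pow_four_rpow ht _ 3 (by norm_num)
    have e5 : (t ^ 4) ^ (-3 / 4 - 1 : ℝ) = (t ^ 7)⁻¹ := pow_four_rpow ht _ 7 (by norm_num)
    have e6 : (t ^ 4) ^ (-3 / 4 - 1 - 1 : ℝ) = (t ^ 11)⁻¹ := pow_four_rpow ht _ 11 (by norm_num)
    have e7 : (t ^ 4) ^ (-1 / 2 - 1 : ℝ) = (t ^ 6)⁻¹ := pow_four_rpow ht _ 6 (by norm_num)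
    constructor
    · rw [lap2_radial_mul hx (fun s hs => hasDerivAt_hamelProfile A μ hs)
        (hasDerivAt_hamelProfileDeriv A μ hs), grad2_radial (hasDerivAt_hamelPressure A μ hs),
        fderiv_radial_mul_apply hG, inner_self_mul, re_hamelProfile]
      beta_reduce
      rw [← mul_assoc (hamelProfile A μ _), ← add_mul, ← add_mul]
      congr 1
      have htc : (t : ℂ) ≠ 0 := by exact_mod_cast ht.ne'
      rw [hts]
      simp only [hamelProfile, hamelProfileDeriv, hamelProfileDeriv₂, e1, e2, e3, e4, e5, e6, e7]
      push_cast
      field_simp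
      ring_nf
      simp only [Complex.I_sq]
      ring
    · rw [div2_radial_mul hG, re_hamelProfile, re_hamelProfileDeriv, hts, e1, e2]
      field_simp
      ring
  · have h (θ : ℝ) : (hamelVelocity A μ (Complex.exp (θ * Complex.I)) *
        (starRingEnd ℂ) (Complex.exp (θ * Complex.I))).re = -(3 / 2) := by
      rw [hamelVelocity_eq, mul_assoc, Complex.mul_conj, Complex.normSq_eq_norm_sq,
        Complex.norm_exp_ofReal_mul_I, Complex.re_mul_ofReal, re_hamelProfile]
      norm_num
    simp only [h, intervalIntegral.integral_const, smul_eq_mul]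
    ring
end
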